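/- arXiv:math/0702446 — 2 statements merged into one kernel-verified Lean document; each statement's English description precedes it below -/
import Mathlib

section
/- For every complex z with Re z > 0, (∫₀¹ (1 − t^{z+1})/(1 − t) dμ(t)) · (∫₀¹ t^z dμ(t)) = 1. -/
open MeasureTheory Set

/-- The fixed point sequence. -/
noncomputable def fpSeq : ℕ → ℝ
  | 0 => 1
  | n + 1 => (-1 + Real.sqrt (1 + 4 * fpSeq n ^ 2)) / (2 * fpSeq n)

/-- The integrand `(1 - t^z)/(1 - t)`, extended continuously by the value `z` at `t = 1`. -/
noncomputable def bernKernel (z : ℂ) (t : ℝ) : ℂ :=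
  if t = 1 then z else (1 - (t : ℂ) ^ z) / (1 - (t : ℂ))

theorem fpSeq_pos (n : ℕ) : 0 < fpSeq n := by
  induction n with
  | zero => simp [fpSeq]
  | succ n ih =>
    rw [fpSeq]
    have h : 1 < Real.sqrt (1 + 4 * fpSeq n ^ 2) := by
      rw [Real.lt_sqrt zero_le_one]
      nlinarith [pow_pos ih 2]
    exact div_pos (by linarith) (by linarith)

theorem fpSeq_succ_quadratic (n : ℕ) :
    fpSeq n * fpSeq (n + 1) ^ 2 + fpSeq (n + 1) = fpSeq n := by
  have h := fpSeq_pos n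
  have hs := Real.sq_sqrt (show 0 ≤ 1 + 4 * fpSeq n ^ 2 by positivity)
  rw [fpSeq]
  generalize √(1 + 4 * fpSeq n ^ 2) = r at hs
  field_simp
  linear_combination hs

theorem sum_fpSeq_mul (n : ℕ) : (∑ k ∈ Finset.range (n + 1), fpSeq k) * fpSeq n = 1 := by
  induction n with
  | zero => simp [fpSeq]
  | succ n ih =>
    rw [Finset.sum_range_succ]
    refine mul_left_cancel₀ (fpSeq_pos n).ne' ?_
    linear_combination fpSeq (n + 1) * ih + fpSeq_succ_quadratic n

/-- A continuous function is integrable for a finite measure carried by a compact interval. -/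
theorem integrable_of_continuous_of_ae_mem_Icc {ν : Measure ℝ} [IsFiniteMeasure ν] {a b : ℝ}
    (hν : ∀ᵐ x ∂ν, x ∈ Icc a b) {f : ℝ → ℝ} (hf : Continuous f) : Integrable f ν := by
  obtain ⟨C, hC⟩ := (isCompact_Icc (a := a) (b := b)).exists_bound_of_continuousOn hf.continuousOn
  exact Integrable.of_bound hf.aestronglyMeasurable C (hν.mono hC)

/-- Finite measures carried by a compact interval are determined by their moments. -/
theorem measure_ext_of_moments {ν ρ : Measure ℝ} [IsFiniteMeasure ν] [IsFiniteMeasure ρ] {a b : ℝ}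
    (hν : ∀ᵐ x ∂ν, x ∈ Icc a b) (hρ : ∀ᵐ x ∂ρ, x ∈ Icc a b)
    (h : ∀ n : ℕ, ∫ x, x ^ n ∂ν = ∫ x, x ^ n ∂ρ) : ν = ρ := by
  have hpoly (p : Polynomial ℝ) : ∫ x, p.eval x ∂ν = ∫ x, p.eval x ∂ρ := by
    simp only [Polynomial.eval_eq_sum_range]
    rw [integral_finsetSum, integral_finsetSum]
    · simp only [integral_const_mul, h]
    · exact fun i _ ↦ integrable_of_continuous_of_ae_mem_Icc hρ (by fun_prop)
    · exact fun i _ ↦ integrable_of_continuous_of_ae_mem_Icc hν (by fun_prop)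
  refine ext_of_forall_integral_eq_of_IsFiniteMeasure fun f ↦ ?_
  have hclose {σ : Measure ℝ} [IsFiniteMeasure σ] (hσ : ∀ᵐ x ∂σ, x ∈ Icc a b) {ε : ℝ}
      {p : Polynomial ℝ} (hp : ∀ x ∈ Icc a b, |p.eval x - f x| < ε) :
      |∫ x, p.eval x ∂σ - ∫ x, f x ∂σ| ≤ ε * σ.real univ := by
    rw [← integral_sub (integrable_of_continuous_of_ae_mem_Icc hσ p.continuous)
      (integrable_of_continuous_of_ae_mem_Icc hσ f.continuous)]
    exact norm_integral_le_of_norm_le_const (f := fun x ↦ p.eval x - f x)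
      (hσ.mono fun x hx ↦ (hp x hx).le)
  refine eq_of_abs_sub_le_all fun ε hε ↦ ?_
  set M := ν.real univ + ρ.real univ + 1
  have hM : 0 < M := by positivity
  obtain ⟨p, hp⟩ := exists_polynomial_near_of_continuousOn a b f f.continuous.continuousOn
    (ε / M) (by positivity)
  have h₁ := abs_le.mp (hclose hν hp)
  have h₂ := abs_le.mp (hclose hρ hp)
  have h₃ : ε / M * ν.real univ + ε / M * ρ.real univ + ε / M = ε := by
    rw [← mul_add, ← mul_add_one, div_mul_cancel₀ _ hM.ne']
  have h₄ : 0 < ε / M := by positivity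
  rw [hpoly p] at h₁
  exact abs_le.mpr ⟨by linarith, by linarith⟩

theorem bernKernel_eq_integral {z : ℂ} (hz : 0 ≤ z.re) (t : ℝ) :
    bernKernel (z + 1) t
      = (z + 1) * ∫ u in Icc (0 : ℝ) 1, ((t + u * (1 - t) : ℝ) : ℂ) ^ z := by
  have hz1 : z + 1 ≠ 0 := fun h ↦ by
    have := congrArg Complex.re h
    simp at this
    linarith
  rw [integral_Icc_eq_integral_Ioc, ← intervalIntegral.integral_of_le zero_le_one]
  unfold bernKernel
  split_ifs with ht
  · simp [ht]
  · have ht' : 1 - t ≠ 0 := sub_ne_zero.mpr (Ne.symm ht)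
    have ht'' : (1 - t : ℂ) ≠ 0 := mod_cast ht'
    have key := intervalIntegral.integral_comp_add_mul (a := 0) (b := 1)
      (fun x : ℝ ↦ (x : ℂ) ^ z) ht' t
    simp only [mul_comm _ (1 - t)]
    rw [key, integral_cpow (Or.inl (by linarith))]
    simp only [mul_one, mul_zero, add_zero, add_sub_cancel, Complex.ofReal_one, Complex.one_cpow,
      Complex.real_smul, Complex.ofReal_inv, Complex.ofReal_sub]
    field_simp

theorem bernKernel_natCast (n : ℕ) (t : ℝ) :
    bernKernel (n + 1) t = ((∑ k ∈ Finset.range (n + 1), t ^ k : ℝ) : ℂ) := by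
  unfold bernKernel
  split_ifs with ht
  · simp [ht]
  · have ht' : (1 - t : ℂ) ≠ 0 := mod_cast sub_ne_zero.mpr (Ne.symm ht)
    rw [div_eq_iff ht']
    have h := geom_sum_mul_neg (t : ℂ) (n + 1)
    push_cast
    rw [h]
    norm_cast

/-- The law of `s * (t + u * (1 - t))`, where `s` and `t` have law `μ`, `u` is uniform on `[0, 1]`,
and the three are independent. -/
noncomputable def mixedLaw (μ : Measure ℝ) : Measure ℝ :=
  (μ.prod (μ.prod (volume.restrict (Icc (0 : ℝ) 1)))).map
    fun p ↦ p.1 * (p.2.1 + p.2.2 * (1 - p.2.1))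

instance isProbabilityMeasure_restrict_Icc_zero_one :
    IsProbabilityMeasure (volume.restrict (Icc (0 : ℝ) 1)) :=
  ⟨by simp⟩

instance isProbabilityMeasure_mixedLaw (μ : Measure ℝ) [IsProbabilityMeasure μ] :
    IsProbabilityMeasure (mixedLaw μ) :=
  Measure.isProbabilityMeasure_map (by fun_prop)

theorem ae_prod_mem_Icc {μ : Measure ℝ} (hμ : ∀ᵐ t ∂μ, t ∈ Icc (0 : ℝ) 1) :
    ∀ᵐ p ∂μ.prod (volume.restrict (Icc (0 : ℝ) 1)), p.1 + p.2 * (1 - p.1) ∈ Icc (0 : ℝ) 1 := by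
  have h₁ : ∀ᵐ p ∂μ.prod (volume.restrict (Icc (0 : ℝ) 1)), p.1 ∈ Icc (0 : ℝ) 1 :=
    Measure.quasiMeasurePreserving_fst.ae hμ
  have h₂ : ∀ᵐ p ∂μ.prod (volume.restrict (Icc (0 : ℝ) 1)), p.2 ∈ Icc (0 : ℝ) 1 :=
    Measure.quasiMeasurePreserving_snd.ae (ae_restrict_mem measurableSet_Icc)
  filter_upwards [h₁, h₂] with p ⟨h1, h2⟩ ⟨h3, h4⟩
  exact ⟨by nlinarith, by nlinarith⟩

theorem ae_triple_mem_Icc {μ : Measure ℝ} [IsProbabilityMeasure μ]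
    (hμ : ∀ᵐ t ∂μ, t ∈ Icc (0 : ℝ) 1) :
    ∀ᵐ p ∂μ.prod (μ.prod (volume.restrict (Icc (0 : ℝ) 1))),
      p.1 ∈ Icc (0 : ℝ) 1 ∧ p.2.1 + p.2.2 * (1 - p.2.1) ∈ Icc (0 : ℝ) 1 :=
  (Measure.quasiMeasurePreserving_fst.ae hμ).and
    (Measure.quasiMeasurePreserving_snd.ae (ae_prod_mem_Icc hμ))

theorem ae_mixedLaw_mem_Icc {μ : Measure ℝ} [IsProbabilityMeasure μ]
    (hμ : ∀ᵐ t ∂μ, t ∈ Icc (0 : ℝ) 1) :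
    ∀ᵐ x ∂mixedLaw μ, x ∈ Icc (0 : ℝ) 1 := by
  refine (ae_map_iff (p := (· ∈ Icc (0 : ℝ) 1)) (by fun_prop) measurableSet_Icc).mpr ?_
  filter_upwards [ae_triple_mem_Icc hμ] with p hp
  exact ⟨mul_nonneg hp.1.1 hp.2.1, mul_le_one₀ hp.1.2 hp.2.1 hp.2.2⟩

theorem integral_bernKernel_mul_integral_cpow {μ : Measure ℝ} [IsProbabilityMeasure μ]
    (hμ : ∀ᵐ t ∂μ, t ∈ Icc (0 : ℝ) 1) {z : ℂ} (hz : 0 ≤ z.re) :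
    (∫ t, bernKernel (z + 1) t ∂μ) * (∫ t : ℝ, (t : ℂ) ^ z ∂μ)
      = (z + 1) * ∫ x : ℝ, (x : ℂ) ^ z ∂mixedLaw μ := by
  have hmeas : Measurable fun x : ℝ ↦ (x : ℂ) ^ z := by fun_prop
  have hint : Integrable (fun p : ℝ × ℝ ↦ ((p.1 + p.2 * (1 - p.1) : ℝ) : ℂ) ^ z)
      (μ.prod (volume.restrict (Icc (0 : ℝ) 1))) := by
    refine Integrable.of_bound (hmeas.comp (by fun_prop)).aestronglyMeasurable 1 ?_
    filter_upwards [ae_prod_mem_Icc hμ] with p hp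
    rcases hp.1.eq_or_lt with h | h
    · rw [← h, Complex.ofReal_zero]
      rcases eq_or_ne z 0 with rfl | h
      · simp
      · simp [Complex.zero_cpow h]
    · rw [Complex.norm_cpow_eq_rpow_re_of_pos h]
      exact Real.rpow_le_one hp.1 hp.2 hz
  have hprod : ∫ x : ℝ, (x : ℂ) ^ z ∂mixedLaw μ
      = ∫ p, (p.1 : ℂ) ^ z * ((p.2.1 + p.2.2 * (1 - p.2.1) : ℝ) : ℂ) ^ z
          ∂μ.prod (μ.prod (volume.restrict (Icc (0 : ℝ) 1))) := by
    rw [mixedLaw, integral_map (by fun_prop) hmeas.aestronglyMeasurable]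
    refine integral_congr_ae ?_
    filter_upwards [ae_triple_mem_Icc hμ] with p hp
    rw [Complex.ofReal_mul, Complex.mul_cpow_ofReal_nonneg hp.1.1 hp.2.1]
  rw [hprod, integral_prod_mul (fun s : ℝ ↦ (s : ℂ) ^ z)
    (fun p : ℝ × ℝ ↦ ((p.1 + p.2 * (1 - p.1) : ℝ) : ℂ) ^ z), integral_prod _ hint]
  simp only [bernKernel_eq_integral hz, integral_const_mul]
  ring

theorem mixedLaw_eq_restrict {μ : Measure ℝ} [IsProbabilityMeasure μ]
    (hμ : ∀ᵐ t ∂μ, t ∈ Icc (0 : ℝ) 1)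
    (hmom : ∀ n : ℕ, ∫ t, t ^ n ∂μ = fpSeq n) :
    mixedLaw μ = volume.restrict (Icc (0 : ℝ) 1) := by
  refine measure_ext_of_moments (ae_mixedLaw_mem_Icc hμ) (ae_restrict_mem measurableSet_Icc)
    fun n ↦ ?_
  have h := integral_bernKernel_mul_integral_cpow hμ (z := n) (by simp)
  simp only [bernKernel_natCast, Complex.cpow_natCast, ← Complex.ofReal_pow,
    integral_complex_ofReal] at h
  rw [integral_finsetSum _ fun k _ ↦
    integrable_of_continuous_of_ae_mem_Icc hμ (continuous_pow k)] at h
  simp only [hmom] at h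
  rw [← Complex.ofReal_mul, sum_fpSeq_mul] at h
  have h' : 1 = ((n : ℝ) + 1) * ∫ x, x ^ n ∂mixedLaw μ := by exact_mod_cast h
  rw [integral_Icc_eq_integral_Ioc, ← intervalIntegral.integral_of_le zero_le_one, integral_pow]
  have hn : (n : ℝ) + 1 ≠ 0 := by positivity
  simp only [one_pow, ne_eq, Nat.succ_ne_zero, not_false_eq_true, zero_pow, sub_zero]
  rw [eq_div_iff hn, mul_comm, ← h']

theorem stmt_1 (μ : Measure ℝ) [IsProbabilityMeasure μ]
    (hsupp : μ (Set.Icc (0:ℝ) 1)ᶜ = 0) (h0 : μ {0} = 0)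
    (hmom : ∀ n : ℕ, ∫ t in Set.Icc (0:ℝ) 1, t ^ n ∂μ = fpSeq n)
    (z : ℂ) (hz : 0 < z.re) :
    (∫ t in Set.Icc (0:ℝ) 1, bernKernel (z + 1) t ∂μ) *
      (∫ t in Set.Icc (0:ℝ) 1, (t : ℂ) ^ z ∂μ) = 1 := by
  have hμ : ∀ᵐ t ∂μ, t ∈ Icc (0 : ℝ) 1 := hsupp
  rw [Measure.restrict_eq_self_of_ae_mem hμ] at hmom ⊢
  have hz1 : z + 1 ≠ 0 := fun h ↦ by
    have := congrArg Complex.re h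
    simp at this
    linarith
  rw [integral_bernKernel_mul_integral_cpow hμ hz.le, mixedLaw_eq_restrict hμ hmom,
    integral_Icc_eq_integral_Ioc, ← intervalIntegral.integral_of_le zero_le_one,
    integral_cpow (Or.inl (by linarith))]
  simp [Complex.zero_cpow hz1, hz1]
end

section
/- For every n ≥ 0, √n ≤ λ_n ≤ √(2n). -/
/-- The sequence `λ₀ = 0`, `λ_{n+1} = (λₙ + √(λₙ² + 4))/2`. -/
noncomputable def lamSeq : ℕ → ℝ
  | 0 => 0
  | n + 1 => (lamSeq n + Real.sqrt (lamSeq n ^ 2 + 4)) / 2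

theorem lamSeq_nonneg (n : ℕ) : 0 ≤ lamSeq n := by
  induction n with
  | zero => simp [lamSeq]
  | succ n ih =>
    rw [lamSeq]
    positivity

theorem lamSeq_sq_add_one_le (n : ℕ) : lamSeq n ^ 2 + 1 ≤ lamSeq (n + 1) ^ 2 := by
  have hs := Real.sq_sqrt (show 0 ≤ lamSeq n ^ 2 + 4 by positivity)
  have hle : lamSeq n ≤ √(lamSeq n ^ 2 + 4) := Real.le_sqrt_of_sq_le (by linarith)
  rw [lamSeq]
  nlinarith [mul_le_mul_of_nonneg_left hle (lamSeq_nonneg n)]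

theorem lamSeq_succ_sq_le (n : ℕ) : lamSeq (n + 1) ^ 2 ≤ lamSeq n ^ 2 + 2 := by
  have hs := Real.sq_sqrt (show 0 ≤ lamSeq n ^ 2 + 4 by positivity)
  rw [lamSeq]
  nlinarith [sq_nonneg (lamSeq n - √(lamSeq n ^ 2 + 4))]

theorem lamSeq_sq_mem_Icc (n : ℕ) : lamSeq n ^ 2 ∈ Set.Icc (n : ℝ) (2 * n) := by
  induction n with
  | zero => simp [lamSeq]
  | succ n ih =>
    have hl := lamSeq_sq_add_one_le n
    have hu := lamSeq_succ_sq_le n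
    push_cast
    exact ⟨by linarith [ih.1], by linarith [ih.2]⟩

theorem stmt_10 (n : ℕ) :
    Real.sqrt n ≤ lamSeq n ∧ lamSeq n ≤ Real.sqrt (2 * n) := by
  exact ⟨(Real.sqrt_le_left (lamSeq_nonneg n)).2 (lamSeq_sq_mem_Icc n).1,
    Real.le_sqrt_of_sq_le (lamSeq_sq_mem_Icc n).2⟩
end
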